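/- arXiv:2503.16590 — 2 statements merged into one kernel-verified Lean document; each statement's English description precedes it below -/
import Mathlib

section
/- Let a < b be reals and let φ : [a, b] → ℝ be continuous and of bounded variation on [a, b]. Define D_φ(t, μ; a, b) = (1/π) ∫_a^b ( sin((μ−y)·t)/(μ−y) )·φ(y) dy. Then for every μ ∈ ℝ, lim_{t→∞} D_φ(t, μ; a, b) exists and equals φ(μ) if a < μ < b, equals φ(μ)/2 if μ = a or μ = b, and equals 0 if μ < a or μ > b. -/
open Real Filter
open MeasureTheory Set in
theorem aux_si_formula (R : ℝ) (hR : 0 < R) :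
    ∫ x in (0:ℝ)..R, sinc x
      = ∫ y in Ioi (0:ℝ), (1 - exp (-R * y) * (cos R + y * sin R)) / (1 + y ^ 2) := by
  have hinner : ∀ x : ℝ, 0 < x → ∫ y in Ioi (0:ℝ), exp (-x * y) = 1 / x := by
    intro x hx
    rw [integral_exp_mul_Ioi (by linarith)]
    simp [neg_div_neg_eq]
  have hint : Integrable (Function.uncurry fun x y : ℝ => sin x * exp (-x * y))
      ((volume.restrict (Ioc 0 R)).prod (volume.restrict (Ioi 0))) := by
    rw [integrable_prod_iff (by
      apply Continuous.aestronglyMeasurable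
      simp only [Function.uncurry_def]
      fun_prop)]
    constructor
    · filter_upwards [ae_restrict_mem measurableSet_Ioc] with x hx
      simp only [Function.uncurry_apply_pair]
      exact (integrableOn_exp_mul_Ioi (a := -x) (by linarith [hx.1]) 0).const_mul _
    · have : IntegrableOn (fun x : ℝ => |sinc x|) (Ioc 0 R) :=
        (continuous_sinc.abs.integrableOn_Icc).mono_set Ioc_subset_Icc_self
      refine this.congr ?_
      filter_upwards [ae_restrict_mem measurableSet_Ioc] with x hx
      simp only [Function.uncurry_apply_pair, norm_mul, norm_eq_abs, abs_exp]
      rw [integral_const_mul, hinner x hx.1, sinc_of_ne_zero hx.1.ne', abs_div, abs_of_pos hx.1]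
      ring
  have hswap := integral_integral_swap hint
  rw [intervalIntegral.integral_of_le hR.le]
  calc ∫ x in Ioc 0 R, sinc x
      = ∫ x in Ioc 0 R, ∫ y in Ioi (0:ℝ), sin x * exp (-x * y) := by
        refine setIntegral_congr_fun measurableSet_Ioc fun x hx => ?_
        rw [integral_const_mul, hinner x hx.1, sinc_of_ne_zero hx.1.ne']
        ring
    _ = ∫ y in Ioi (0:ℝ), ∫ x in Ioc 0 R, sin x * exp (-x * y) := hswap
    _ = _ := by
        refine setIntegral_congr_fun measurableSet_Ioi fun y hy => ?_
        rw [← intervalIntegral.integral_of_le hR.le]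
        have hy2 : (1 + y ^ 2) ≠ 0 := by positivity
        rw [intervalIntegral.integral_eq_sub_of_hasDerivAt
          (f := fun x => - exp (-x * y) * (cos x + y * sin x) / (1 + y ^ 2))]
        · simp; field_simp; ring
        · intro x _
          have h1 : HasDerivAt (fun x : ℝ => exp (-x * y)) (exp (-x * y) * (-1 * y)) x :=
            (((hasDerivAt_id x).neg).mul_const y).exp
          have h2 : HasDerivAt (fun x : ℝ => cos x + y * sin x) (-sin x + y * cos x) x :=
            (hasDerivAt_cos x).add ((hasDerivAt_sin x).const_mul y)
          refine ((h1.neg.mul h2).div_const (1 + y ^ 2)).congr_deriv ?_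
          simp only [Pi.neg_apply]
          field_simp
          ring
        · apply Continuous.intervalIntegrable
          fun_prop

open MeasureTheory Set in
theorem aux_si_bound (R : ℝ) (hR : 0 < R) : |(∫ x in (0:ℝ)..R, sinc x) - π / 2| ≤ 1 / R := by
  have hpi : ∫ y in Ioi (0:ℝ), (1 + y ^ 2)⁻¹ = π / 2 := by
    rw [integral_Ioi_inv_one_add_sq]; simp
  have hle : ∀ y : ℝ, ‖exp (-R * y) * (cos R + y * sin R) / (1 + y ^ 2)‖ ≤ exp (-R * y) := by
    intro y
    have hpos : 0 < 1 + y ^ 2 := by positivity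
    rw [norm_div, norm_mul, norm_eq_abs, norm_eq_abs, norm_eq_abs, abs_exp, abs_of_pos hpos,
      div_le_iff₀ hpos]
    gcongr
    have h := sin_sq_add_cos_sq R
    apply abs_le_of_sq_le_sq _ hpos.le
    nlinarith [sq_nonneg (y * cos R - sin R), sq_nonneg y, sq_nonneg (y^2)]
  have hexp : IntegrableOn (fun y => exp (-R * y)) (Ioi 0) :=
    integrableOn_exp_mul_Ioi (by linarith) 0
  have hi : IntegrableOn (fun y => exp (-R * y) * (cos R + y * sin R) / (1 + y ^ 2)) (Ioi 0) := by
    refine Integrable.mono' hexp ?_ (Eventually.of_forall hle)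
    apply Continuous.aestronglyMeasurable
    refine Continuous.div (by fun_prop) (by fun_prop) (fun y => by positivity)
  rw [aux_si_formula R hR, ← hpi, ← integral_sub]
  · calc _ = |∫ y in Ioi (0:ℝ), exp (-R * y) * (cos R + y * sin R) / (1 + y ^ 2)| := by
          rw [← abs_neg, ← integral_neg]
          congr 2
          ext y
          ring
      _ ≤ ∫ y in Ioi (0:ℝ), exp (-R * y) :=
          norm_integral_le_of_norm_le hexp (Eventually.of_forall hle)
      _ = 1 / R := by
          rw [integral_exp_mul_Ioi (by linarith)]
          simp [neg_div_neg_eq]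
  · have := integrable_inv_one_add_sq.integrableOn (s := Ioi (0:ℝ)) |>.sub hi
    refine this.congr (Eventually.of_forall fun y => ?_)
    simp only [Pi.sub_apply]
    ring
  · exact integrable_inv_one_add_sq.integrableOn

theorem aux_si_tendsto : Tendsto (fun R : ℝ => ∫ x in (0:ℝ)..R, sinc x) atTop (nhds (π / 2)) := by
  rw [tendsto_iff_norm_sub_tendsto_zero]
  refine squeeze_zero' (Eventually.of_forall fun _ => norm_nonneg _) ?_
    (tendsto_const_nhds.div_atTop tendsto_id : Tendsto (fun R : ℝ => 1 / R) atTop (nhds 0))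
  filter_upwards [eventually_gt_atTop 0] with R hR using aux_si_bound R hR

theorem aux_si_bdd (R : ℝ) (hR : 0 ≤ R) : |∫ x in (0:ℝ)..R, sinc x| ≤ π / 2 + 1 := by
  rcases le_total R 1 with h | h
  · have := intervalIntegral.norm_integral_le_of_norm_le_const (a := 0) (b := R) (f := sinc) (C := 1)
      (fun x _ => abs_sinc_le_one x)
    rw [norm_eq_abs, sub_zero, abs_of_nonneg hR] at this
    linarith [pi_pos]
  · have h1 := aux_si_bound R (by linarith)
    have h2 : 1 / R ≤ 1 := by rw [div_le_one (by linarith)]; exact h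
    have h3 := abs_le.1 (h1.trans h2)
    rw [abs_le]; constructor <;> linarith [pi_pos]

open MeasureTheory Set in
theorem aux_parts (f : StieltjesFunction ℝ) (c : ℝ) (hc : 0 < c) (h : ℝ → ℝ) (hh : Continuous h) :
    ∫ u in (0:ℝ)..c, h u * f u
      = f 0 * (∫ u in (0:ℝ)..c, h u) + ∫ s in Ioc 0 c, (∫ u in s..c, h u) ∂f.measure := by
  have : IsFiniteMeasure (f.measure.restrict (Ioc 0 c)) := ⟨by simp [f.measure_Ioc]⟩
  have hmeas : MeasurableSet {p : ℝ × ℝ | p.2 ≤ p.1} := measurableSet_le measurable_snd measurable_fst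
  have hind : Integrable (Function.uncurry fun u s : ℝ => h u * (Iic u).indicator (fun _ => (1:ℝ)) s)
      ((volume.restrict (Ioc 0 c)).prod (f.measure.restrict (Ioc 0 c))) := by
    have h1 : Integrable (fun p : ℝ × ℝ => h p.1)
        ((volume.restrict (Ioc 0 c)).prod (f.measure.restrict (Ioc 0 c))) := by
      have : Integrable h (volume.restrict (Ioc 0 c)) :=
        (hh.integrableOn_Icc).mono_set Ioc_subset_Icc_self
      exact this.comp_fst _
    refine (h1.indicator hmeas).congr (Eventually.of_forall fun p => ?_)
    simp [Set.indicator, Function.uncurry]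
  have hswap := integral_integral_swap hind
  have hf : IntervalIntegrable f volume 0 c := f.mono.intervalIntegrable
  have e1 : ∀ u ∈ Ioc 0 c, ∫ s in Ioc 0 c, h u * (Iic u).indicator (fun _ => (1:ℝ)) s ∂f.measure
      = h u * f u - f 0 * h u := by
    intro u hu
    rw [integral_const_mul, integral_indicator measurableSet_Iic]
    have : Iic u ∩ Ioc 0 c = Ioc 0 u := by
      ext x; simp only [mem_inter_iff, mem_Iic, mem_Ioc]
      constructor
      · rintro ⟨h1, h2, h3⟩; exact ⟨h2, h1⟩
      · rintro ⟨h1, h2⟩; exact ⟨h2, h1, h2.trans hu.2⟩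
    simp only [integral_const, smul_eq_mul, mul_one, measureReal_def]
    rw [Measure.restrict_restrict measurableSet_Iic, this]
    simp only [MeasurableSet.univ, Measure.restrict_apply, univ_inter, f.measure_Ioc]
    rw [ENNReal.toReal_ofReal (sub_nonneg.2 (f.mono hu.1.le))]
    ring
  have e2 : ∀ s ∈ Ioc 0 c, ∫ u in Ioc 0 c, h u * (Iic u).indicator (fun _ => (1:ℝ)) s
      = ∫ u in s..c, h u := by
    intro s hs
    have : ∀ u, h u * (Iic u).indicator (fun _ => (1:ℝ)) s = (Ici s).indicator h u := by
      intro u; simp [Set.indicator]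
    simp_rw [this]
    rw [integral_indicator measurableSet_Ici, Measure.restrict_restrict measurableSet_Ici,
      intervalIntegral.integral_of_le hs.2, ← integral_Icc_eq_integral_Ioc]
    congr 2
    ext x; simp only [mem_inter_iff, mem_Ici, mem_Ioc, mem_Icc]
    constructor
    · rintro ⟨h1, h2, h3⟩; exact ⟨h1, h3⟩
    · rintro ⟨h1, h2⟩; exact ⟨h1, hs.1.trans_le h1, h2⟩
  rw [setIntegral_congr_fun measurableSet_Ioc e1, setIntegral_congr_fun measurableSet_Ioc e2,
    ← intervalIntegral.integral_of_le hc.le, intervalIntegral.integral_sub,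
    intervalIntegral.integral_const_mul] at hswap
  · linarith
  · exact hf.continuousOn_mul hh.continuousOn
  · exact (hh.intervalIntegrable _ _).const_mul _

theorem aux_scale (t s c : ℝ) : ∫ u in s..c, t * sinc (t * u)
    = (∫ x in (0:ℝ)..(t * c), sinc x) - ∫ x in (0:ℝ)..(t * s), sinc x := by
  rw [intervalIntegral.integral_const_mul, intervalIntegral.mul_integral_comp_mul_left,
    intervalIntegral.integral_interval_sub_left] <;>
  exact continuous_sinc.intervalIntegrable _ _

open MeasureTheory Set in
theorem aux_stieltjes (f : StieltjesFunction ℝ) (c : ℝ) (hc : 0 < c) :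
    Tendsto (fun t : ℝ => ∫ u in (0:ℝ)..c, t * sinc (t * u) * f u) atTop (nhds (f 0 * (π / 2))) := by
  have : IsFiniteMeasure (f.measure.restrict (Ioc 0 c)) := ⟨by simp [f.measure_Ioc]⟩
  have hlim : ∀ s : ℝ, 0 < s →
      Tendsto (fun t : ℝ => ∫ x in (0:ℝ)..(t * s), sinc x) atTop (nhds (π / 2)) := fun s hs =>
    aux_si_tendsto.comp (tendsto_id.atTop_mul_const hs)
  have hcont : Continuous fun R : ℝ => ∫ x in (0:ℝ)..R, sinc x :=
    intervalIntegral.continuous_primitive (fun a b => continuous_sinc.intervalIntegrable a b) 0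
  have key : Tendsto (fun t : ℝ => ∫ s in Ioc 0 c,
      ((∫ x in (0:ℝ)..(t * c), sinc x) - ∫ x in (0:ℝ)..(t * s), sinc x) ∂f.measure) atTop
      (nhds (∫ s in Ioc 0 c, (0:ℝ) ∂f.measure)) := by
    refine tendsto_integral_filter_of_dominated_convergence (fun _ => (π / 2 + 1) + (π / 2 + 1))
      ?_ ?_ (integrable_const _) ?_
    · refine Eventually.of_forall fun t => Continuous.aestronglyMeasurable ?_
      exact continuous_const.sub (hcont.comp (continuous_const.mul continuous_id))
    · filter_upwards [eventually_ge_atTop 0] with t ht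
      filter_upwards [ae_restrict_mem measurableSet_Ioc] with s hs
      refine (norm_sub_le _ _).trans (add_le_add ?_ ?_)
      · exact aux_si_bdd _ (mul_nonneg ht hc.le)
      · exact aux_si_bdd _ (mul_nonneg ht hs.1.le)
    · filter_upwards [ae_restrict_mem measurableSet_Ioc] with s hs
      simpa using (hlim c hc).sub (hlim s hs.1)
  have h2 := ((hlim c hc).const_mul (f 0)).add key
  simp only [integral_zero, add_zero] at h2
  refine h2.congr fun t => ?_
  rw [aux_parts f c hc (fun u => t * sinc (t * u))
    (continuous_const.mul (continuous_sinc.comp (continuous_const.mul continuous_id)))]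
  simp only [aux_scale]
  simp

open MeasureTheory Set in
theorem aux_bv (ψ : ℝ → ℝ) (hψ : Continuous ψ) (hbv : LocallyBoundedVariationOn ψ univ)
    (c : ℝ) (hc : 0 < c) :
    Tendsto (fun t : ℝ => ∫ u in (0:ℝ)..c, t * sinc (t * u) * ψ u) atTop
      (nhds (ψ 0 * (π / 2))) := by
  obtain ⟨p, q, hp, hq, hpq⟩ := hbv.exists_monotoneOn_sub_monotoneOn
  rw [monotoneOn_univ] at hp hq
  have heq : ∀ x, ψ x = hp.stieltjesFunction x - hq.stieltjesFunction x := by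
    intro x
    rw [hp.stieltjesFunction_eq, hq.stieltjesFunction_eq]
    have h1 := (hp.tendsto_rightLim x).sub (hq.tendsto_rightLim x)
    have h2 : Tendsto ψ (nhdsWithin x (Ioi x)) (nhds (ψ x)) := hψ.continuousWithinAt
    refine tendsto_nhds_unique h2 (h1.congr fun y => ?_)
    rw [hpq]; rfl
  have h := (aux_stieltjes hp.stieltjesFunction c hc).sub (aux_stieltjes hq.stieltjesFunction c hc)
  rw [← sub_mul, ← heq] at h
  refine h.congr fun t => ?_
  have hc' : Continuous fun u => t * sinc (t * u) :=
    continuous_const.mul (continuous_sinc.comp (continuous_const.mul continuous_id))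
  rw [← intervalIntegral.integral_sub]
  · simp only [heq, mul_sub]
  · exact (Monotone.intervalIntegrable hp.stieltjesFunction.mono).continuousOn_mul hc'.continuousOn
  · exact (Monotone.intervalIntegrable hq.stieltjesFunction.mono).continuousOn_mul hc'.continuousOn

open Set in
theorem aux_bv_all (ψ : ℝ → ℝ) (hψ : Continuous ψ) (hbv : LocallyBoundedVariationOn ψ univ)
    (hbv' : LocallyBoundedVariationOn (fun x => ψ (-x)) univ) (c : ℝ) :
    Tendsto (fun t : ℝ => ∫ u in (0:ℝ)..c, t * sinc (t * u) * ψ u) atTop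
      (nhds (SignType.sign c * (ψ 0 * (π / 2)))) := by
  rcases lt_trichotomy c 0 with h | h | h
  · have := (aux_bv (fun x => ψ (-x)) (hψ.comp continuous_neg) hbv' (-c) (by linarith)).neg
    simp only [neg_zero] at this
    simp only [sign_neg h, SignType.coe_neg_one, neg_one_mul]
    refine this.congr fun t => ?_
    have e := intervalIntegral.integral_comp_neg (a := 0) (b := -c)
      (fun u => t * sinc (t * u) * ψ u)
    simp only [mul_neg, sinc_neg, neg_neg, neg_zero] at e
    rw [e, intervalIntegral.integral_symm, neg_neg]
  · subst h; simp
  · simpa [sign_pos h] using aux_bv ψ hψ hbv c h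

open Set MeasureTheory in
/-- The limit of the Dirichlet-type integral. -/
theorem dirichlet_phi_limit (a b : ℝ) (hab : a < b) (φ : ℝ → ℝ)
    (hφcont : ContinuousOn φ (Set.Icc a b))
    (hφBV : BoundedVariationOn φ (Set.Icc a b)) (μ : ℝ) :
    Tendsto (fun t : ℝ => (1 / π) * ∫ y in a..b, Real.sin ((μ - y) * t) / (μ - y) * φ y)
      atTop
      (nhds (if a < μ ∧ μ < b then φ μ else if μ = a ∨ μ = b then φ μ / 2 else 0)) := by
  set g : ℝ → ℝ := fun u => max a (min b (u + μ)) with hg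
  have hgm : Monotone g := fun x y hxy => by simp only [hg]; gcongr
  have hgI : ∀ u, g u ∈ Icc a b := fun u =>
    ⟨le_max_left _ _, max_le hab.le (min_le_left _ _)⟩
  have hgc : Continuous g := by simp only [hg]; fun_prop
  have hψ : Continuous (fun u => φ (g u)) := hφcont.comp_continuous hgc hgI
  have hbv : LocallyBoundedVariationOn (fun u => φ (g u)) univ := by
    apply BoundedVariationOn.locallyBoundedVariationOn
    exact ne_top_of_le_ne_top hφBV
      (eVariationOn.comp_le_of_monotoneOn φ g (hgm.monotoneOn _) fun u _ => hgI u)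
  have hbv' : LocallyBoundedVariationOn (fun u => φ (g (-u))) univ := by
    apply BoundedVariationOn.locallyBoundedVariationOn
    exact ne_top_of_le_ne_top hφBV
      (eVariationOn.comp_le_of_antitoneOn φ (fun u => g (-u))
        (fun x _ y _ hxy => hgm (neg_le_neg hxy)) fun u _ => hgI _)
  have h := ((aux_bv_all _ hψ hbv hbv' (b - μ)).sub (aux_bv_all _ hψ hbv hbv' (a - μ))).const_mul
    (1 / π)
  have hint : ∀ t, (∫ u in (0:ℝ)..(b - μ), t * sinc (t * u) * φ (g u))
      - (∫ u in (0:ℝ)..(a - μ), t * sinc (t * u) * φ (g u))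
      = ∫ y in a..b, Real.sin ((μ - y) * t) / (μ - y) * φ y := by
    intro t
    have hk : Continuous fun u => t * sinc (t * u) * φ (g u) :=
      (continuous_const.mul (continuous_sinc.comp (continuous_const.mul continuous_id))).mul hψ
    rw [intervalIntegral.integral_interval_sub_left (hk.intervalIntegrable _ _)
      (hk.intervalIntegrable _ _),
      ← intervalIntegral.integral_comp_sub_right (fun u => t * sinc (t * u) * φ (g u)) μ]
    refine intervalIntegral.integral_congr_ae ?_
    have : ∀ᵐ y : ℝ, y ≠ μ := by simp [ae_iff]
    filter_upwards [this] with y hy hyI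
    rw [uIoc_of_le hab.le] at hyI
    have hgy : g (y - μ) = y := by
      simp only [hg, sub_add_cancel]
      rw [min_eq_right hyI.2, max_eq_right hyI.1.le]
    rw [hgy]
    congr 1
    have h1 : y - μ ≠ 0 := sub_ne_zero.2 hy
    have h2 : μ - y ≠ 0 := sub_ne_zero.2 hy.symm
    by_cases ht : t = 0
    · simp [ht]
    · rw [sinc_of_ne_zero (mul_ne_zero ht h1), show (μ - y) * t = -(t * (y - μ)) by ring, sin_neg,
        show μ - y = -(y - μ) by ring]
      field_simp
  simp only [hint] at h
  convert h using 2
  have hpi := pi_ne_zero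
  have hg0 : a ≤ μ → μ ≤ b → g 0 = μ := by
    intro h1 h2
    simp only [hg, zero_add]
    rw [min_eq_right h2, max_eq_right h1]
  rcases lt_trichotomy μ a with h1 | h1 | h1
  · have h2 : μ < b := h1.trans hab
    rw [if_neg (by rintro ⟨h, _⟩; linarith), if_neg (by rintro (h | h) <;> linarith),
      sign_pos (by linarith), sign_pos (by linarith)]
    simp
  · subst h1
    rw [hg0 le_rfl hab.le, if_neg (by simp), if_pos (by simp), sign_pos (by linarith)]
    simp
    field_simp
  · rcases lt_trichotomy μ b with h2 | h2 | h2
    · rw [hg0 h1.le h2.le, if_pos ⟨h1, h2⟩, sign_pos (by linarith), sign_neg (by linarith)]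
      simp
      field_simp
      ring
    · subst h2
      rw [hg0 hab.le le_rfl, if_neg (by simp), if_pos (by simp), sign_neg (by linarith : a - μ < 0)]
      simp
      field_simp
    · rw [if_neg (by rintro ⟨_, h⟩; linarith), if_neg (by rintro (h | h) <;> linarith),
        sign_neg (by linarith), sign_neg (by linarith)]
      simp
end

section
/- Under the stated assumptions on φ, a, b and μ, for every t > 0 with min( t·δ, t·(b−a) ) ≥ 2 one has | D_φ(t, μ; a, b) − D_{φ,∞}(μ; a, b) | ≤ 4·C_μ(φ)/(π·t) + (4·‖φ‖_∞/t)·( 1/(b−a) + 3/δ ). -/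
open Real Filter


lemma si_bound {X : ℝ} (hX : 0 < X) : |(∫ x in (0:ℝ)..X, sinc x) - π / 2| ≤ 1 / X := by
  have hint : MeasureTheory.Integrable (Function.uncurry fun x y : ℝ => exp (-x * y) * sin x)
      ((MeasureTheory.volume.restrict (Set.uIoc 0 X)).prod
        (MeasureTheory.volume.restrict (Set.Ioi (0:ℝ)))) := by
    rw [MeasureTheory.integrable_prod_iff (by
      apply Continuous.aestronglyMeasurable
      unfold Function.uncurry
      fun_prop)]
    rw [Set.uIoc_of_le hX.le]
    constructor
    · refine (MeasureTheory.ae_restrict_iff' measurableSet_Ioc).2 (MeasureTheory.ae_of_all _ fun x hx => ?_)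
      exact (integrableOn_exp_mul_Ioi (neg_lt_zero.2 hx.1) 0).mul_const (sin x)
    · have : MeasureTheory.Integrable (fun x => |sinc x|)
          (MeasureTheory.volume.restrict (Set.Ioc 0 X)) := by
        have := (continuous_sinc.abs).intervalIntegrable (μ := MeasureTheory.volume) 0 X
        exact this.1
      refine this.congr ?_
      refine (MeasureTheory.ae_restrict_iff' measurableSet_Ioc).2 (MeasureTheory.ae_of_all _ fun x hx => ?_)
      simp only [Function.uncurry, norm_mul, Real.norm_eq_abs, abs_exp]
      rw [MeasureTheory.integral_mul_const, integral_exp_mul_Ioi (neg_lt_zero.2 hx.1) 0,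
        sinc_of_ne_zero hx.1.ne', abs_div, abs_of_pos hx.1]
      have := hx.1.ne'
      simp
      field_simp
  have h1 : (∫ x in (0:ℝ)..X, sinc x) =
      ∫ x in (0:ℝ)..X, ∫ y in Set.Ioi (0:ℝ), exp (-x * y) * sin x := by
    rw [intervalIntegral.integral_of_le hX.le, intervalIntegral.integral_of_le hX.le]
    refine MeasureTheory.setIntegral_congr_fun measurableSet_Ioc fun x hx => ?_
    rw [MeasureTheory.integral_mul_const, integral_exp_mul_Ioi (neg_lt_zero.2 hx.1) 0,
        sinc_of_ne_zero hx.1.ne']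
    have := hx.1.ne'
    simp
    field_simp
  have h2 : ∀ y : ℝ, (∫ x in (0:ℝ)..X, exp (-x * y) * sin x) =
      (1 + y ^ 2)⁻¹ - exp (-X * y) * (cos X + y * sin X) / (1 + y ^ 2) := by
    intro y
    have hy : (1 + y ^ 2) ≠ 0 := by positivity
    have hd : ∀ x ∈ Set.uIcc 0 X, HasDerivAt
        (fun x => -(exp (-x * y) * (cos x + y * sin x) / (1 + y ^ 2)))
        (exp (-x * y) * sin x) x := by
      intro x _
      have e1 : HasDerivAt (fun x : ℝ => exp (-x * y)) (exp (-x * y) * (-1 * y)) x :=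
        (((hasDerivAt_id x).neg).mul_const y).exp
      have e2 : HasDerivAt (fun x : ℝ => cos x + y * sin x) (-sin x + y * cos x) x :=
        (hasDerivAt_cos x).add ((hasDerivAt_sin x).const_mul y)
      refine ((e1.mul e2).div_const (1 + y ^ 2)).neg.congr_deriv ?_
      field_simp
      ring
    rw [intervalIntegral.integral_eq_sub_of_hasDerivAt hd
      (Continuous.intervalIntegrable (by fun_prop) _ _)]
    simp
    ring
  rw [h1, MeasureTheory.intervalIntegral_integral_swap hint]
  have h3 : π / 2 = ∫ y in Set.Ioi (0:ℝ), (1 + y ^ 2)⁻¹ := by simp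
  have hi : MeasureTheory.Integrable (fun y : ℝ => ∫ x in (0:ℝ)..X, exp (-x * y) * sin x)
      (MeasureTheory.volume.restrict (Set.Ioi (0:ℝ))) := by
    have := hint.integral_prod_right
    simpa [intervalIntegral.integral_of_le hX.le, Set.uIoc_of_le hX.le, Function.uncurry] using this
  rw [h3, ← MeasureTheory.integral_sub hi integrable_inv_one_add_sq.integrableOn]
  have h4 : 1 / X = ∫ y in Set.Ioi (0:ℝ), exp (-X * y) := by
    rw [integral_exp_mul_Ioi (neg_lt_zero.2 hX) 0]; simp
  rw [h4, ← Real.norm_eq_abs]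
  refine MeasureTheory.norm_integral_le_of_norm_le
    (integrableOn_exp_mul_Ioi (neg_lt_zero.2 hX) 0) (MeasureTheory.ae_of_all _ fun y => ?_)
  rw [h2 y, sub_sub_cancel_left, norm_neg, norm_div, norm_mul, Real.norm_eq_abs, abs_exp,
    Real.norm_eq_abs, Real.norm_eq_abs, abs_of_pos (by positivity : 0 < 1 + y ^ 2), mul_div_assoc]
  refine mul_le_of_le_one_right (exp_pos _).le ((div_le_one (by positivity)).2 ?_)
  refine abs_le_of_sq_le_sq ?_ (by positivity)
  nlinarith [sin_sq_add_cos_sq X, sq_nonneg (sin X - y * cos X), sq_nonneg y,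
    sq_nonneg (y^2)]

lemma bv_intervalIntegrable {f : ℝ → ℝ} {c d : ℝ} (hcd : c ≤ d)
    (hf : BoundedVariationOn f (Set.Icc c d)) :
    IntervalIntegrable f MeasureTheory.volume c d := by
  obtain ⟨p, q, hp, hq, rfl⟩ := hf.locallyBoundedVariationOn.exists_monotoneOn_sub_monotoneOn
  rw [← Set.uIcc_of_le hcd] at hp hq
  exact hp.intervalIntegrable.sub hq.intervalIntegrable

lemma bv_step {f v : ℝ → ℝ} {x y t : ℝ} (ht : 0 < t) (hxy : x ≤ y)
    (hi : IntervalIntegrable f MeasureTheory.volume x y)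
    (hv : ∀ z ∈ Set.Icc x y, |f z - f x| ≤ v y - v x) :
    |(∫ z in x..y, sin (z * t) * f z) - (-(cos (y * t) / t) * f y - -(cos (x * t) / t) * f x)|
      ≤ (v y - v x) / t + (v y - v x) * (y - x) := by
  have hs : (∫ z in x..y, sin (z * t)) = -(cos (y * t) / t) - -(cos (x * t) / t) := by
    have hd : ∀ z ∈ Set.uIcc x y, HasDerivAt (fun z => -(cos (z * t) / t)) (sin (z * t)) z := by
      intro z _
      have := (((hasDerivAt_id z).mul_const t).cos.div_const t).neg
      refine this.congr_deriv ?_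
      simp
      field_simp
    rw [intervalIntegral.integral_eq_sub_of_hasDerivAt hd
      (Continuous.intervalIntegrable (by fun_prop) _ _)]
  have hsc : Continuous fun z : ℝ => sin (z * t) := by fun_prop
  have h1 : (∫ z in x..y, sin (z * t) * f z) =
      (∫ z in x..y, sin (z * t) * (f z - f x)) +
        (-(cos (y * t) / t) - -(cos (x * t) / t)) * f x := by
    rw [← hs, ← intervalIntegral.integral_mul_const, ← intervalIntegral.integral_add]
    · congr 1; ext z; ring
    · exact (hi.sub intervalIntegrable_const).continuousOn_mul hsc.continuousOn
    · exact (hsc.mul continuous_const).intervalIntegrable _ _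
  have h2 : |∫ z in x..y, sin (z * t) * (f z - f x)| ≤ (v y - v x) * (y - x) := by
    have := intervalIntegral.norm_integral_le_of_norm_le_const (a := x) (b := y)
      (f := fun z => sin (z * t) * (f z - f x)) (C := v y - v x) (by
        intro z hz
        rw [Set.uIoc_of_le hxy] at hz
        rw [norm_mul, Real.norm_eq_abs, Real.norm_eq_abs]
        have h := hv z ⟨hz.1.le, hz.2⟩
        nlinarith [abs_sin_le_one (z * t), abs_nonneg (f z - f x)])
    rwa [Real.norm_eq_abs, abs_of_nonneg (sub_nonneg.2 hxy)] at this
  have h3 : |cos (y * t) / t * (f y - f x)| ≤ (v y - v x) / t := by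
    rw [abs_mul, abs_div, abs_of_pos ht, div_mul_eq_mul_div]
    gcongr
    have h := hv y ⟨hxy, le_rfl⟩
    nlinarith [abs_cos_le_one (y * t), abs_nonneg (f y - f x)]
  rw [h1]
  have : (∫ z in x..y, sin (z * t) * (f z - f x)) +
        (-(cos (y * t) / t) - -(cos (x * t) / t)) * f x -
        (-(cos (y * t) / t) * f y - -(cos (x * t) / t) * f x) =
      cos (y * t) / t * (f y - f x) + ∫ z in x..y, sin (z * t) * (f z - f x) := by ring
  rw [this]
  exact (abs_add_le _ _).trans (add_le_add h3 h2)

lemma bv_bound {f : ℝ → ℝ} {c d t S : ℝ} (ht : 0 < t) (hcd : c ≤ d)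
    (hf : BoundedVariationOn f (Set.Icc c d)) (hS : ∀ z ∈ Set.Icc c d, |f z| ≤ S) :
    |∫ z in c..d, sin (z * t) * f z| ≤ (2 * S + (eVariationOn f (Set.Icc c d)).toReal) / t := by
  set V := (eVariationOn f (Set.Icc c d)).toReal with hV
  set v := variationOnFromTo f (Set.Icc c d) c with hvdef
  have hl := hf.locallyBoundedVariationOn
  have hc : c ∈ Set.Icc c d := ⟨le_rfl, hcd⟩
  have hd : d ∈ Set.Icc c d := ⟨hcd, le_rfl⟩
  have hvd : v d = V := by rw [hvdef, variationOnFromTo.eq_of_le _ _ hcd, Set.inter_self]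
  have hvc : v c = 0 := variationOnFromTo.self _ _ _
  have hii := bv_intervalIntegrable hcd hf
  have hsc : Continuous fun z : ℝ => sin (z * t) := by fun_prop
  have key : ∀ n : ℕ, |(∫ z in c..d, sin (z * t) * f z) -
      (-(cos (d * t) / t) * f d - -(cos (c * t) / t) * f c)| ≤
      V / t + V * ((d - c) * (1 / ((n:ℝ) + 1))) := by
    intro n
    set h := (d - c) * (1 / ((n:ℝ) + 1)) with hh
    have hn : (0:ℝ) < n + 1 := by positivity
    have hh0 : 0 ≤ h := mul_nonneg (sub_nonneg.2 hcd) (by positivity)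
    have hhn : h * (n + 1) = d - c := by rw [hh]; field_simp
    set u : ℕ → ℝ := fun k => c + k * h with hu
    have hmem : ∀ k ≤ n + 1, u k ∈ Set.Icc c d := by
      intro k hk
      have hk' : (k:ℝ) ≤ n + 1 := by exact_mod_cast hk
      constructor
      · simp only [hu]; have : 0 ≤ (k:ℝ) * h := by positivity
        linarith
      · simp only [hu]; nlinarith
    have hle : ∀ k, u k ≤ u (k + 1) := by
      intro k; simp only [hu]; push_cast; linarith
    have hu0 : u 0 = c := by simp [hu]
    have hun : u (n + 1) = d := by simp only [hu]; push_cast; linarith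
    have hik : ∀ k < n + 1, IntervalIntegrable f MeasureTheory.volume (u k) (u (k + 1)) := by
      intro k hk
      refine hii.mono_set ?_
      rw [Set.uIcc_of_le (hle k), Set.uIcc_of_le hcd]
      exact Set.Icc_subset_Icc (hmem k hk.le).1 (hmem (k+1) hk).2
    have h1 := intervalIntegral.sum_integral_adjacent_intervals (n := n + 1) (a := u)
      (f := fun z => sin (z * t) * f z) (μ := MeasureTheory.volume)
      (fun k hk => (hik k hk).continuousOn_mul hsc.continuousOn)
    have h2 := Finset.sum_range_sub (fun k => -(cos (u k * t) / t) * f (u k)) (n + 1)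
    have h3 := Finset.sum_range_sub (fun k => v (u k)) (n + 1)
    simp only [hu0, hun] at h1 h2 h3
    rw [← h1, ← h2, ← Finset.sum_sub_distrib]
    refine (Finset.abs_sum_le_sum_abs _ _).trans ?_
    have h4 : ∀ k ∈ Finset.range (n + 1), |(∫ z in u k..u (k+1), sin (z * t) * f z) -
        (-(cos (u (k+1) * t) / t) * f (u (k+1)) - -(cos (u k * t) / t) * f (u k))| ≤
        (v (u (k+1)) - v (u k)) * (1 / t + h) := by
      intro k hk
      have hk := Finset.mem_range.1 hk
      have := bv_step (v := v) ht (hle k) (hik k hk) (by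
        intro z hz
        have hz' : z ∈ Set.Icc c d :=
          ⟨(hmem k hk.le).1.trans hz.1, hz.2.trans (hmem (k+1) hk).2⟩
        refine (variationOnFromTo.abs_sub_le_sub_of_le hl hc (hmem k hk.le) hz' hz.1).trans ?_
        have := variationOnFromTo.monotoneOn hl hc hz' (hmem (k+1) hk) hz.2
        linarith)
      refine this.trans (le_of_eq ?_)
      have : u (k + 1) - u k = h := by simp only [hu]; push_cast; ring
      rw [this]; ring
    refine (Finset.sum_le_sum h4).trans (le_of_eq ?_)
    rw [← Finset.sum_mul, h3, hvd, hvc]; ring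
  have hlim : Tendsto (fun n : ℕ => V / t + V * ((d - c) * (1 / ((n:ℝ) + 1)))) atTop
      (nhds (V / t + V * ((d - c) * 0))) :=
    ((tendsto_one_div_add_atTop_nhds_zero_nat.const_mul _).const_mul _).const_add _
  have hfin := ge_of_tendsto' hlim key
  have hb : ∀ z ∈ Set.Icc c d, |cos (z * t) / t * f z| ≤ S / t := by
    intro z hz
    rw [abs_mul, abs_div, abs_of_pos ht, div_mul_eq_mul_div]
    gcongr
    have h := hS z hz
    nlinarith [abs_cos_le_one (z * t), abs_nonneg (f z)]
  have e1 := abs_le.1 (hb c hc)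
  have e2 := abs_le.1 (hb d hd)
  have e3 := abs_le.1 hfin
  have : (2 * S + V) / t = S / t + S / t + V / t := by ring
  rw [this, abs_le]
  constructor <;> linarith [e1.1, e1.2, e2.1, e2.2, e3.1, e3.2]

lemma kernel_eq {X t : ℝ} (ht : 0 < t) :
    (∫ z in (0:ℝ)..X, t * sinc (z * t)) = ∫ x in (0:ℝ)..X * t, sinc x := by
  rw [intervalIntegral.integral_const_mul, intervalIntegral.integral_comp_mul_right _ ht.ne']
  simp [ht.ne']

lemma kernel_pos {X t : ℝ} (ht : 0 < t) (hX : 0 < X) :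
    |(∫ z in (0:ℝ)..X, t * sinc (z * t)) - π / 2| ≤ 1 / (t * X) := by
  rw [kernel_eq ht, mul_comm t X]
  exact si_bound (by positivity)

lemma kernel_reflect {p q t : ℝ} :
    (∫ z in (-q)..(-p), t * sinc (z * t)) = ∫ z in p..q, t * sinc (z * t) := by
  rw [← intervalIntegral.integral_comp_neg]
  simp [sinc_neg]

lemma kernel_intervalIntegrable (p q t : ℝ) :
    IntervalIntegrable (fun z => t * sinc (z * t)) MeasureTheory.volume p q :=
  Continuous.intervalIntegrable
    (continuous_const.mul (continuous_sinc.comp (continuous_id.mul continuous_const))) _ _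

lemma kernel_far {p q t : ℝ} (ht : 0 < t) (hp : 0 < p) (hpq : p ≤ q) :
    |∫ z in p..q, t * sinc (z * t)| ≤ 2 / (t * p) := by
  have h1 := kernel_pos ht hp
  have h2 := kernel_pos ht (hp.trans_le hpq)
  have h3 : 1 / (t * q) ≤ 1 / (t * p) := by gcongr
  have h4 := intervalIntegral.integral_add_adjacent_intervals
    (kernel_intervalIntegrable 0 p t) (kernel_intervalIntegrable p q t)
  have h5 : 2 / (t * p) = 1 / (t * p) + 1 / (t * p) := by ring
  rw [abs_le] at *
  rw [h5]
  constructor <;> linarith [h1.1, h1.2, h2.1, h2.2]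

lemma piece {W ψ : ℝ → ℝ} {p q t S c s : ℝ} (ht : 0 < t) (hpq : p ≤ q) (hs : |s| = 1)
    (hW : BoundedVariationOn W (Set.Icc p q)) (hS : ∀ z ∈ Set.Icc p q, |W z| ≤ S)
    (hψ : ∀ z ∈ Set.Icc p q, z ≠ 0 → ψ z = c + s * (z * W z)) :
    |(∫ z in p..q, sin (z * t) / z * ψ z) - c * ∫ z in p..q, t * sinc (z * t)| ≤
      (2 * S + (eVariationOn W (Set.Icc p q)).toReal) / t ∧
    IntervalIntegrable (fun z => sin (z * t) / z * ψ z) MeasureTheory.volume p q := by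
  have hsc : Continuous fun z : ℝ => sin (z * t) := by fun_prop
  have i1 : IntervalIntegrable (fun z => c * (t * sinc (z * t))) MeasureTheory.volume p q :=
    (kernel_intervalIntegrable p q t).const_mul c
  have i2 : IntervalIntegrable (fun z => s * (sin (z * t) * W z)) MeasureTheory.volume p q :=
    ((bv_intervalIntegrable hpq hW).continuousOn_mul hsc.continuousOn).const_mul s
  have hae : ∀ᵐ z : ℝ, z ≠ 0 := by simp [MeasureTheory.ae_iff]
  have hcong : ∀ᵐ z : ℝ, z ∈ Set.uIoc p q →
      c * (t * sinc (z * t)) + s * (sin (z * t) * W z) = sin (z * t) / z * ψ z := by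
    filter_upwards [hae] with z hz hzm
    rw [Set.uIoc_of_le hpq] at hzm
    rw [hψ z ⟨hzm.1.le, hzm.2⟩ hz, sinc_of_ne_zero (mul_ne_zero hz ht.ne')]
    field_simp
  constructor
  · rw [← intervalIntegral.integral_congr_ae hcong, intervalIntegral.integral_add i1 i2,
      intervalIntegral.integral_const_mul c, intervalIntegral.integral_const_mul s,
      add_sub_cancel_left,
      abs_mul, hs, one_mul]
    exact bv_bound ht hpq hW hS
  · refine (i1.add i2).congr_ae ?_
    rw [Filter.EventuallyEq, MeasureTheory.ae_restrict_iff' measurableSet_uIoc]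
    exact hcong

lemma bv_le_iSup {W : ℝ → ℝ} {p q : ℝ} (hW : BoundedVariationOn W (Set.Icc p q)) :
    ∀ z ∈ Set.Icc p q, |W z| ≤ ⨆ z : Set.Icc p q, |W ↑z| := by
  intro z hz
  refine le_ciSup (f := fun z : Set.Icc p q => |W ↑z|) ?_ ⟨z, hz⟩
  refine ⟨|W z| + (eVariationOn W (Set.Icc p q)).toReal, ?_⟩
  rintro _ ⟨w, rfl⟩
  have := hW.dist_le w.2 hz
  rw [Real.dist_eq] at this
  have h2 := abs_add_le (W w - W z) (W z)
  simp only [sub_add_cancel] at h2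
  simp only
  linarith

lemma var_mono {W : ℝ → ℝ} {s u : Set ℝ} (hW : BoundedVariationOn W u) (h : s ⊆ u) :
    (eVariationOn W s).toReal ≤ (eVariationOn W u).toReal :=
  ENNReal.toReal_mono hW (eVariationOn.mono _ h)

/-- The case where `μ` lies outside `[a, b]`. -/
lemma outside {A c t S V M δ B : ℝ} (ht : 0 < t) (hδ : 0 < δ) (hS : 0 ≤ S) (hV : 0 ≤ V)
    (hM : 0 ≤ M) {J : ℝ} (hA : |A - c * J| ≤ (2 * S + V) / t) (hJ : |J| ≤ 2 / (t * δ))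
    (hc : |c| ≤ M + δ * S) (hB : 0 < B) :
    |1 / π * A - 0| ≤ 4 * (S + V) / (π * t) + (4 * M / t) * (1 / B + 3 / δ) := by
  have hπ := pi_pos
  have h1 : |c * J| ≤ (M + δ * S) * (2 / (t * δ)) := by
    rw [abs_mul]; gcongr
  have h2 : |A| ≤ (2 * S + V) / t + (M + δ * S) * (2 / (t * δ)) := by
    have := abs_add_le (A - c * J) (c * J)
    rw [sub_add_cancel] at this
    linarith
  have h3 : (2 * S + V) / t + (M + δ * S) * (2 / (t * δ)) = (4 * S + V) / t + 2 * M / (t * δ) := by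
    field_simp; ring
  rw [h3] at h2
  rw [sub_zero, abs_mul, abs_of_pos (by positivity : 0 < 1 / π)]
  have h4 : 1 / π * |A| ≤ 1 / π * ((4 * S + V) / t + 2 * M / (t * δ)) := by gcongr
  have h5 : 1 / π * (2 * M / (t * δ)) ≤ 1 * (2 * M / (t * δ)) := by
    gcongr
    rw [div_le_one hπ]; linarith [pi_gt_three]
  have h6 : 1 / π * ((4 * S + V) / t) ≤ 4 * (S + V) / (π * t) := by
    rw [one_div_mul_eq_div, div_div, mul_comm t π]; gcongr; linarith
  have h7 : 0 ≤ (4 * M / t) * (1 / B) := by positivity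
  have h8 : 0 ≤ M / (t * δ) := by positivity
  have h9 : (4 * M / t) * (1 / B + 3 / δ) = (4 * M / t) * (1 / B) + 12 * (M / (t * δ)) := by
    field_simp
    ring
  have h10 : 2 * M / (t * δ) = 2 * (M / (t * δ)) := by ring
  rw [h9]
  rw [mul_add (1 / π) (_ / t)] at h4
  linarith

/-- The case where `μ` lies inside `(a, b)`. -/
lemma inside {A₁ A₂ J₁ J₂ c t S₁ V₁ S₂ V₂ M δ B : ℝ} (ht : 0 < t) (hδ : 0 < δ)
    (hS₁ : 0 ≤ S₁) (hV₁ : 0 ≤ V₁) (hS₂ : 0 ≤ S₂) (hV₂ : 0 ≤ V₂)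
    (hM : 0 ≤ M) (hA₁ : |A₁ - c * J₁| ≤ (2 * S₁ + V₁) / t) (hA₂ : |A₂ - c * J₂| ≤ (2 * S₂ + V₂) / t)
    (hJ₁ : |J₁ - π / 2| ≤ 1 / (t * δ)) (hJ₂ : |J₂ - π / 2| ≤ 1 / (t * δ))
    (hc : |c| ≤ M) (hB : 0 < B) :
    |1 / π * (A₁ + A₂) - c| ≤
      4 * (S₁ + V₁ + S₂ + V₂) / (π * t) + (4 * M / t) * (1 / B + 3 / δ) := by
  have hπ := pi_pos
  have e : 1 / π * (A₁ + A₂) - c = 1 / π * ((A₁ - c * J₁) + (A₂ - c * J₂) +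
      c * ((J₁ - π / 2) + (J₂ - π / 2))) := by field_simp; ring
  have h0 : |(J₁ - π / 2) + (J₂ - π / 2)| ≤ 1 / (t * δ) + 1 / (t * δ) :=
    (abs_add_le _ _).trans (add_le_add hJ₁ hJ₂)
  have h1 : |c * ((J₁ - π / 2) + (J₂ - π / 2))| ≤ M * (1 / (t * δ) + 1 / (t * δ)) := by
    rw [abs_mul]; gcongr
  have h2 : |(A₁ - c * J₁) + (A₂ - c * J₂) + c * ((J₁ - π / 2) + (J₂ - π / 2))| ≤
      (2 * S₁ + V₁) / t + (2 * S₂ + V₂) / t + M * (1 / (t * δ) + 1 / (t * δ)) :=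
    (abs_add_three _ _ _).trans (by gcongr)
  rw [e, abs_mul, abs_of_pos (by positivity : 0 < 1 / π)]
  have h4 : 1 / π * |(A₁ - c * J₁) + (A₂ - c * J₂) + c * ((J₁ - π / 2) + (J₂ - π / 2))| ≤ 1 / π *
    ((2 * S₁ + V₁ + 2 * S₂ + V₂) / t + 2 * (M / (t * δ))) := by
    gcongr
    refine h2.trans (le_of_eq ?_)
    ring
  have h5 : 1 / π * (2 * (M / (t * δ))) ≤ 1 * (2 * (M / (t * δ))) := by
    gcongr
    rw [div_le_one hπ]; linarith [pi_gt_three]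
  have h6 : 1 / π * ((2 * S₁ + V₁ + 2 * S₂ + V₂) / t) ≤ 4 * (S₁ + V₁ + S₂ + V₂) / (π * t) := by
    rw [one_div_mul_eq_div, div_div, mul_comm t π]; gcongr; linarith
  have h7 : 0 ≤ (4 * M / t) * (1 / B) := by positivity
  have h8 : 0 ≤ M / (t * δ) := by positivity
  have h9 : (4 * M / t) * (1 / B + 3 / δ) = (4 * M / t) * (1 / B) + 12 * (M / (t * δ)) := by
    field_simp
    ring
  rw [h9]
  rw [mul_add (1 / π) (_ / t)] at h4
  linarith

/-- Speed of convergence of `D_φ(t, μ; a, b)` to its limit `D_{φ,∞}(μ; a, b)`: under the bounded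
variation assumptions on the difference-quotient functions `W_μ^±`, for every `t > 0` with
`min(tδ, t(b−a)) ≥ 2` one has
`|D_φ(t, μ; a, b) − D_{φ,∞}(μ; a, b)| ≤ 4 C_μ(φ)/(πt) + (4‖φ‖_∞/t)(1/(b−a) + 3/δ)`. -/
theorem dirichlet_phi_speed_of_convergence
    (a b : ℝ) (hab : a < b)
    (U : Set ℝ) (hU : U.OrdConnected) (hUab : Set.Icc a b ⊆ U)
    (μ : ℝ) (hμU : μ ∈ U) (hμa : μ ≠ a) (hμb : μ ≠ b)
    (φ : ℝ → ℝ) (hφcont : ContinuousOn φ (Set.Icc a b))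
    (hφBV : BoundedVariationOn φ (Set.Icc a b))
    (Wm Wp : ℝ → ℝ)
    (hWm : ∀ z : ℝ, 0 < z → z ≤ μ - a → Wm z = (φ (μ - z) - φ μ) / z)
    (hWm0 : Tendsto (fun z : ℝ => (φ (μ - z) - φ μ) / z)
      (nhdsWithin 0 (Set.Ioi 0)) (nhds (Wm 0)))
    (hWp : ∀ z : ℝ, μ - b ≤ z → z < 0 → Wp z = -((φ (μ - z) - φ μ) / z))
    (hWp0 : Tendsto (fun z : ℝ => (φ (μ - z) - φ μ) / z)
      (nhdsWithin 0 (Set.Iio 0)) (nhds (-(Wp 0))))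
    (hBVm : BoundedVariationOn Wm (Set.Icc 0 (μ - a)))
    (hBVp : BoundedVariationOn Wp (Set.Icc (μ - b) 0))
    (Cφ : ℝ)
    (hC : Cφ = (⨆ z : Set.Icc (0:ℝ) (μ - a), |Wm ↑z|) +
        (eVariationOn Wm (Set.Icc 0 (μ - a))).toReal +
        (⨆ z : Set.Icc (μ - b) (0:ℝ), |Wp ↑z|) +
        (eVariationOn Wp (Set.Icc (μ - b) 0)).toReal)
    (M : ℝ) (hM : M = ⨆ y : Set.Icc a b, |φ ↑y|)
    (δ : ℝ) (hδ : δ = min |μ - a| |μ - b|)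
    (Dφ : ℝ → ℝ)
    (hD : ∀ t, Dφ t = (1 / π) * ∫ y in a..b, Real.sin ((μ - y) * t) / (μ - y) * φ y)
    (Dinf : ℝ)
    (hDinf : Dinf = if a < μ ∧ μ < b then φ μ else if μ = a ∨ μ = b then φ μ / 2 else 0)
    (t : ℝ) (ht : 0 < t) (hcond : 2 ≤ min (t * δ) (t * (b - a))) :
    |Dφ t - Dinf| ≤ 4 * Cφ / (π * t) + (4 * M / t) * (1 / (b - a) + 3 / δ) := by
  have hδ0 : 0 < δ := by
    rw [hδ]
    exact lt_min (abs_pos.2 (sub_ne_zero.2 hμa)) (abs_pos.2 (sub_ne_zero.2 hμb))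
  have hB : 0 < b - a := sub_pos.2 hab
  have hMle : ∀ y ∈ Set.Icc a b, |φ y| ≤ M := by
    rw [hM]; exact bv_le_iSup hφBV
  have hM0 : 0 ≤ M := (abs_nonneg _).trans (hMle a ⟨le_rfl, hab.le⟩)
  have hDt : Dφ t = 1 / π * ∫ z in (μ - b)..(μ - a), sin (z * t) / z * φ (μ - z) := by
    rw [hD, ← intervalIntegral.integral_comp_sub_left
      (fun z => sin (z * t) / z * φ (μ - z)) μ]
    simp
  have hSm := bv_le_iSup hBVm
  have hSp := bv_le_iSup hBVp
  set Sm := ⨆ z : Set.Icc (0:ℝ) (μ - a), |Wm ↑z| with hSmdef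
  set Sp := ⨆ z : Set.Icc (μ - b) (0:ℝ), |Wp ↑z| with hSpdef
  have hSm0 : 0 ≤ Sm := Real.iSup_nonneg fun _ => abs_nonneg _
  have hSp0 : 0 ≤ Sp := Real.iSup_nonneg fun _ => abs_nonneg _
  set Vm := (eVariationOn Wm (Set.Icc 0 (μ - a))).toReal with hVm
  set Vp := (eVariationOn Wp (Set.Icc (μ - b) 0)).toReal with hVp
  have hVm0 : 0 ≤ Vm := ENNReal.toReal_nonneg
  have hVp0 : 0 ≤ Vp := ENNReal.toReal_nonneg
  have hψm : ∀ z, 0 < z → z ≤ μ - a → φ (μ - z) = φ μ + 1 * (z * Wm z) := by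
    intro z hz hz'
    rw [hWm z hz hz']; field_simp; ring
  have hψp : ∀ z, μ - b ≤ z → z < 0 → φ (μ - z) = φ μ + (-1) * (z * Wp z) := by
    intro z hz hz'
    rw [hWp z hz hz']
    have := hz'.ne
    field_simp; ring
  have hCm : 4 * (Sm + Vm) / (π * t) ≤ 4 * Cφ / (π * t) := by
    have := pi_pos
    gcongr; rw [hC]; linarith
  have hCp : 4 * (Sp + Vp) / (π * t) ≤ 4 * Cφ / (π * t) := by
    have := pi_pos
    gcongr; rw [hC]; linarith
  rw [hDt]
  rcases lt_or_gt_of_ne hμa with h | h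
  · have hD0 : Dinf = 0 := by
      rw [hDinf, if_neg (fun h' => h.not_gt h'.1), if_neg (by simp [hμa, hμb])]
    have hδe : δ = a - μ := by
      rw [hδ, abs_of_neg (by linarith), abs_of_neg (by linarith), min_eq_left (by linarith)]; ring
    have hsub : Set.Icc (μ - b) (μ - a) ⊆ Set.Icc (μ - b) 0 :=
      Set.Icc_subset_Icc le_rfl (by linarith)
    have hp := (piece (ψ := fun z => φ (μ - z)) (c := φ μ) (s := -1) ht
      (by linarith : μ - b ≤ μ - a) (by simp) (hBVp.mono hsub)
      (fun z hz => hSp z (hsub hz))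
      (fun z hz _ => hψp z hz.1 (by linarith [hz.2]))).1
    have hv := var_mono hBVp hsub
    have hJ : |∫ z in (μ - b)..(μ - a), t * sinc (z * t)| ≤ 2 / (t * δ) := by
      have := kernel_far (p := a - μ) (q := b - μ) ht (by linarith) (by linarith)
      rw [← kernel_reflect, neg_sub, neg_sub, ← hδe] at this
      exact this
    have hc : |φ μ| ≤ M + δ * Sp := by
      have h1 := hψp (μ - a) (by linarith) (by linarith)
      rw [sub_sub_cancel] at h1
      have h2 : φ μ = φ a + -(δ * Wp (μ - a)) := by rw [h1, hδe]; ring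
      rw [h2]
      refine (abs_add_le _ _).trans (add_le_add (hMle a ⟨le_rfl, hab.le⟩) ?_)
      rw [abs_neg, abs_mul, abs_of_pos hδ0]
      gcongr
      exact hSp _ ⟨by linarith, by linarith⟩
    rw [hD0]
    refine (outside (V := Vp) ht hδ0 hSp0 hVp0 hM0 (hp.trans ?_) hJ hc hB).trans ?_
    · gcongr
    · gcongr
  · rcases lt_or_gt_of_ne hμb with h' | h'
    · have hD0 : Dinf = φ μ := by rw [hDinf, if_pos ⟨h, h'⟩]
      have hδ1 : δ ≤ μ - a := by
        rw [hδ]; exact (min_le_left _ _).trans (by rw [abs_of_pos (by linarith)])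
      have hδ2 : δ ≤ b - μ := by
        rw [hδ]; exact (min_le_right _ _).trans (by rw [abs_of_neg (by linarith)]; linarith)
      obtain ⟨p1, i1⟩ := piece (ψ := fun z => φ (μ - z)) (c := φ μ) (s := -1) ht
        (by linarith : μ - b ≤ 0) (by simp) hBVp hSp
        (fun z hz h0 => hψp z hz.1 (lt_of_le_of_ne hz.2 h0))
      obtain ⟨p2, i2⟩ := piece (ψ := fun z => φ (μ - z)) (c := φ μ) (s := 1) ht
        (by linarith : 0 ≤ μ - a) (by simp) hBVm hSm
        (fun z hz h0 => hψm z (lt_of_le_of_ne hz.1 h0.symm) hz.2)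
      have j1 : |(∫ z in (μ - b)..0, t * sinc (z * t)) - π / 2| ≤ 1 / (t * δ) := by
        have := kernel_pos (X := b - μ) ht (by linarith)
        rw [← kernel_reflect, neg_sub, neg_zero] at this
        exact this.trans (by gcongr)
      have j2 : |(∫ z in 0..(μ - a), t * sinc (z * t)) - π / 2| ≤ 1 / (t * δ) :=
        (kernel_pos (X := μ - a) ht (by linarith)).trans (by gcongr)
      rw [hD0, ← intervalIntegral.integral_add_adjacent_intervals i1 i2]
      refine (inside ht hδ0 hSp0 hVp0 hSm0 hVm0 hM0 p1 p2 j1 j2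
        (hMle μ ⟨h.le, h'.le⟩) hB).trans (le_of_eq ?_)
      rw [hC]; ring
    · have hD0 : Dinf = 0 := by
        rw [hDinf, if_neg (fun h'' => h'.not_gt h''.2), if_neg (by simp [hμa, hμb])]
      have hδe : δ = μ - b := by
        rw [hδ, abs_of_pos (by linarith), abs_of_pos (by linarith), min_eq_right (by linarith)]
      have hsub : Set.Icc (μ - b) (μ - a) ⊆ Set.Icc 0 (μ - a) :=
        Set.Icc_subset_Icc (by linarith) le_rfl
      have hp := (piece (ψ := fun z => φ (μ - z)) (c := φ μ) (s := 1) ht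
        (by linarith : μ - b ≤ μ - a) (by simp) (hBVm.mono hsub)
        (fun z hz => hSm z (hsub hz))
        (fun z hz _ => hψm z (by linarith [hz.1]) hz.2)).1
      have hv := var_mono hBVm hsub
      have hJ : |∫ z in (μ - b)..(μ - a), t * sinc (z * t)| ≤ 2 / (t * δ) := by
        rw [hδe]
        exact kernel_far (p := μ - b) (q := μ - a) ht (by linarith) (by linarith)
      have hc : |φ μ| ≤ M + δ * Sm := by
        have h1 := hψm (μ - b) (by linarith) (by linarith)
        rw [sub_sub_cancel] at h1
        have h2 : φ μ = φ b + -(δ * Wm (μ - b)) := by rw [h1, hδe]; ring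
        rw [h2]
        refine (abs_add_le _ _).trans (add_le_add (hMle b ⟨hab.le, le_rfl⟩) ?_)
        rw [abs_neg, abs_mul, abs_of_pos hδ0]
        gcongr
        exact hSm _ ⟨by linarith, by linarith⟩
      rw [hD0]
      refine (outside (V := Vm) ht hδ0 hSm0 hVm0 hM0 (hp.trans ?_) hJ hc hB).trans ?_
      · gcongr
      · gcongr
end
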